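/- arXiv:1411.6041 — 4 statements merged into one kernel-verified Lean document; each statement's English description precedes it below -/
import Mathlib

section
/- Suppose 𝔤 = I₁ ⊕ I₂ is an internal direct sum of two θ-stable ideals I₁, I₂, and set 𝔭ᵢ = 𝔭 ∩ Iᵢ. If 𝔞 is an abelian subalgebra of 𝔤 contained in 𝔭 and maximal among such, then 𝔞 = (𝔞 ∩ I₁) ⊕ (𝔞 ∩ I₂), and for i = 1,2 the subalgebra 𝔞 ∩ Iᵢ is an abelian subalgebra contained in 𝔭ᵢ that is maximal among abelian subalgebras of Iᵢ contained in 𝔭ᵢ. -/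
open scoped InnerProductSpace

section Splitting

variable {R L : Type*} [CommRing R] [LieRing L] [LieAlgebra R L] {θ : L →ₗ⁅R⁆ L}
  {I J : LieIdeal R L} {a : Submodule R L}

/-- An element of `𝔭` centralizing a maximal abelian subspace `𝔞` of `𝔭` lies in `𝔞`. -/
theorem mem_of_maximal_abelian_of_commutes
    (haP : ∀ x ∈ a, θ x = -x) (haAb : ∀ x ∈ a, ∀ y ∈ a, ⁅x, y⁆ = (0 : L))
    (haMax : ∀ b : Submodule R L, (∀ x ∈ b, θ x = -x) →
      (∀ x ∈ b, ∀ y ∈ b, ⁅x, y⁆ = (0 : L)) → a ≤ b → b = a)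
    {z : L} (hz : θ z = -z) (hza : ∀ y ∈ a, ⁅z, y⁆ = 0) : z ∈ a := by
  have hb : a ⊔ R ∙ z = a := by
    refine haMax _ ?_ ?_ le_sup_left
    · intro x hx
      obtain ⟨y, hy, w, hw, rfl⟩ := Submodule.mem_sup.mp hx
      obtain ⟨c, rfl⟩ := Submodule.mem_span_singleton.mp hw
      rw [map_add, map_smul, haP y hy, hz]
      module
    · intro x hx y hy
      obtain ⟨x, hxa, w, hw, rfl⟩ := Submodule.mem_sup.mp hx
      obtain ⟨c, rfl⟩ := Submodule.mem_span_singleton.mp hw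
      obtain ⟨y, hya, w, hw, rfl⟩ := Submodule.mem_sup.mp hy
      obtain ⟨d, rfl⟩ := Submodule.mem_span_singleton.mp hw
      have hxz : ⁅x, z⁆ = 0 := by rw [← lie_skew, hza x hxa, neg_zero]
      simp [haAb x hxa y hya, hza y hya, hxz]
  rw [← hb]
  exact Submodule.mem_sup_right (Submodule.mem_span_singleton_self z)

/-- Elements of two ideals with trivial intersection commute. -/
theorem lie_eq_zero_of_mem_of_mem_of_inf_eq_bot
    (hinf : I.toSubmodule ⊓ J.toSubmodule = ⊥) {x y : L} (hx : x ∈ I) (hy : y ∈ J) :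
    ⁅x, y⁆ = 0 := by
  have h : ⁅x, y⁆ ∈ I.toSubmodule ⊓ J.toSubmodule :=
    ⟨lie_mem_left R L I x y hx, lie_mem_right R L J x y hy⟩
  rwa [hinf, Submodule.mem_bot] at h

/-- If `𝔞 ⊆ 𝔭` is abelian and contains every element of `𝔭` centralizing it, then `𝔞` contains
the components of its elements along a decomposition into `θ`-stable ideals. -/
theorem left_component_mem
    (hI : ∀ x ∈ I, θ x ∈ I) (hJ : ∀ x ∈ J, θ x ∈ J)
    (hinf : I.toSubmodule ⊓ J.toSubmodule = ⊥) (hsup : I.toSubmodule ⊔ J.toSubmodule = ⊤)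
    (haP : ∀ x ∈ a, θ x = -x) (haAb : ∀ x ∈ a, ∀ y ∈ a, ⁅x, y⁆ = (0 : L))
    (hmem : ∀ z, θ z = -z → (∀ y ∈ a, ⁅z, y⁆ = 0) → z ∈ a)
    {u v : L} (hu : u ∈ I) (hv : v ∈ J) (huv : u + v ∈ a) : u ∈ a := by
  have key : ∀ p ∈ I, ∀ q ∈ J, p + q = 0 → p = 0 := by
    intro p hp q hq h
    have hpJ : p ∈ J := by rw [eq_neg_of_add_eq_zero_left h]; exact neg_mem hq
    have hpIJ : p ∈ I.toSubmodule ⊓ J.toSubmodule := ⟨hp, hpJ⟩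
    rwa [hinf, Submodule.mem_bot] at hpIJ
  refine hmem u ?_ fun y hy => ?_
  · refine eq_neg_of_add_eq_zero_left
      (key _ (add_mem (hI u hu) hu) _ (add_mem (hJ v hv) hv) ?_)
    have h := haP _ huv
    rw [map_add] at h
    rw [add_add_add_comm, h, neg_add_cancel]
  · obtain ⟨p, hp, q, hq, rfl⟩ := Submodule.mem_sup.mp (hsup ▸ Submodule.mem_top : y ∈ _)
    have huq : ⁅u, q⁆ = 0 := lie_eq_zero_of_mem_of_mem_of_inf_eq_bot hinf hu hq
    have hvp : ⁅v, p⁆ = 0 :=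
      lie_eq_zero_of_mem_of_mem_of_inf_eq_bot (inf_comm _ _ |>.trans hinf) hv hp
    have h := haAb _ huv _ hy
    rw [add_lie, lie_add, lie_add, huq, hvp, add_zero, zero_add] at h
    rw [lie_add, huq, add_zero]
    exact key _ (lie_mem_left R L I u p hu) _ (lie_mem_left R L J v q hv) h

/-- If `𝔞` is the sum of its intersections with two ideals meeting trivially and contains every
element of `𝔭` centralizing it, then its intersection with the first ideal is maximal abelian. -/
theorem eq_inf_of_abelian_of_le
    (hinf : I.toSubmodule ⊓ J.toSubmodule = ⊥)
    (hsplit : a ≤ (a ⊓ I.toSubmodule) ⊔ (a ⊓ J.toSubmodule))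
    (hmem : ∀ z, θ z = -z → (∀ y ∈ a, ⁅z, y⁆ = 0) → z ∈ a)
    {b : Submodule R L} (hbI : b ≤ I.toSubmodule) (hbP : ∀ x ∈ b, θ x = -x)
    (hbAb : ∀ x ∈ b, ∀ y ∈ b, ⁅x, y⁆ = (0 : L)) (hab : a ⊓ I.toSubmodule ≤ b) :
    b = a ⊓ I.toSubmodule := by
  refine le_antisymm (fun z hz => ⟨hmem z (hbP z hz) fun y hy => ?_, hbI hz⟩) hab
  obtain ⟨p, hp, q, hq, rfl⟩ := Submodule.mem_sup.mp (hsplit hy)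
  rw [lie_add, hbAb z hz p (hab hp),
    lie_eq_zero_of_mem_of_mem_of_inf_eq_bot hinf (hbI hz) hq.2, add_zero]

end Splitting

noncomputable section

/- `𝔤` is a finite-dimensional real semisimple Lie algebra with Cartan involution `θ`
and decomposition `𝔤 = 𝔨 ⊕ 𝔭`, where `𝔭 = {x | θ x = -x}`. -/
variable (g : Type*) [LieRing g] [LieAlgebra ℝ g] [FiniteDimensional ℝ g]
  (θ : g →ₗ⁅ℝ⁆ g)

/-- If `𝔤 = I₁ ⊕ I₂` is a direct sum of `θ`-stable ideals and `𝔞` is a maximal abelian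
subalgebra contained in `𝔭`, then `𝔞 = (𝔞 ∩ I₁) ⊕ (𝔞 ∩ I₂)` and each `𝔞 ∩ Iᵢ` is a
maximal abelian subalgebra of `Iᵢ` contained in `𝔭ᵢ = 𝔭 ∩ Iᵢ`. -/
theorem maximal_abelian_splits
    [LieAlgebra.IsSemisimple ℝ g]
    (hinv : ∀ x : g, θ (θ x) = x)
    (hpos : ∀ x : g, x ≠ 0 → 0 < -(killingForm ℝ g x (θ x)))
    (I₁ I₂ : LieIdeal ℝ g)
    (hI₁ : ∀ x ∈ I₁, θ x ∈ I₁) (hI₂ : ∀ x ∈ I₂, θ x ∈ I₂)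
    (hinf : I₁.toSubmodule ⊓ I₂.toSubmodule = ⊥)
    (hsup : I₁.toSubmodule ⊔ I₂.toSubmodule = ⊤)
    (a : Submodule ℝ g)
    (haP : ∀ x ∈ a, θ x = -x)
    (haAb : ∀ x ∈ a, ∀ y ∈ a, ⁅x, y⁆ = (0 : g))
    (haMax : ∀ b : Submodule ℝ g, (∀ x ∈ b, θ x = -x) →
      (∀ x ∈ b, ∀ y ∈ b, ⁅x, y⁆ = (0 : g)) → a ≤ b → b = a) :
    a = (a ⊓ I₁.toSubmodule) ⊔ (a ⊓ I₂.toSubmodule) ∧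
    (a ⊓ I₁.toSubmodule) ⊓ (a ⊓ I₂.toSubmodule) = ⊥ ∧
    (∀ x ∈ a ⊓ I₁.toSubmodule, θ x = -x ∧ x ∈ I₁) ∧
    (∀ x ∈ a ⊓ I₂.toSubmodule, θ x = -x ∧ x ∈ I₂) ∧
    (∀ x ∈ a ⊓ I₁.toSubmodule, ∀ y ∈ a ⊓ I₁.toSubmodule, ⁅x, y⁆ = (0 : g)) ∧
    (∀ x ∈ a ⊓ I₂.toSubmodule, ∀ y ∈ a ⊓ I₂.toSubmodule, ⁅x, y⁆ = (0 : g)) ∧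
    (∀ b : Submodule ℝ g, b ≤ I₁.toSubmodule → (∀ x ∈ b, θ x = -x) →
      (∀ x ∈ b, ∀ y ∈ b, ⁅x, y⁆ = (0 : g)) → a ⊓ I₁.toSubmodule ≤ b →
        b = a ⊓ I₁.toSubmodule) ∧
    (∀ b : Submodule ℝ g, b ≤ I₂.toSubmodule → (∀ x ∈ b, θ x = -x) →
      (∀ x ∈ b, ∀ y ∈ b, ⁅x, y⁆ = (0 : g)) → a ⊓ I₂.toSubmodule ≤ b →
        b = a ⊓ I₂.toSubmodule) := by
  have hmem : ∀ z, θ z = -z → (∀ y ∈ a, ⁅z, y⁆ = 0) → z ∈ a := fun z hz hza =>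
    mem_of_maximal_abelian_of_commutes haP haAb haMax hz hza
  have hsplit : a ≤ (a ⊓ I₁.toSubmodule) ⊔ (a ⊓ I₂.toSubmodule) := by
    intro x hx
    obtain ⟨u, hu, v, hv, rfl⟩ := Submodule.mem_sup.mp (hsup ▸ Submodule.mem_top : x ∈ _)
    have hua : u ∈ a := left_component_mem hI₁ hI₂ hinf hsup haP haAb hmem hu hv hx
    have hva : v ∈ a := (Submodule.add_mem_iff_right a hua).mp hx
    exact Submodule.add_mem_sup ⟨hua, hu⟩ ⟨hva, hv⟩
  refine ⟨le_antisymm hsplit (sup_le inf_le_left inf_le_left), ?_,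
    fun x hx => ⟨haP x hx.1, hx.2⟩, fun x hx => ⟨haP x hx.1, hx.2⟩,
    fun x hx y hy => haAb x hx.1 y hy.1, fun x hx y hy => haAb x hx.1 y hy.1,
    fun b hbI hbP hbAb hab => eq_inf_of_abelian_of_le hinf hsplit hmem hbI hbP hbAb hab,
    fun b hbI hbP hbAb hab => eq_inf_of_abelian_of_le (inf_comm _ _ |>.trans hinf)
      (hsplit.trans_eq (sup_comm _ _)) hmem hbI hbP hbAb hab⟩
  exact le_bot_iff.mp ((inf_le_inf inf_le_right inf_le_right).trans_eq hinf)

end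
end

section
/- Let 𝔮 ⊆ 𝔭 be a linear subspace with [𝔨, 𝔮] ⊆ 𝔮, and let 𝔮' be the orthogonal complement of 𝔮 in 𝔭 with respect to B. Then: (i) [𝔮, 𝔮'] = 0; (ii) the subspace 𝔥 = [𝔮,𝔮] + 𝔮 of 𝔤 and its B-orthogonal complement 𝔥' in 𝔤 are θ-stable ideals of 𝔤 satisfying 𝔤 = 𝔥 ⊕ 𝔥' and [𝔥, 𝔥'] = 0. -/
open scoped InnerProductSpace

noncomputable section

/- `𝔤` is a finite-dimensional real semisimple Lie algebra with Cartan involution `θ`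
and decomposition `𝔤 = 𝔨 ⊕ 𝔭`, where `𝔨 = {x | θ x = x}` and `𝔭 = {x | θ x = -x}`. -/
variable (g : Type*) [LieRing g] [LieAlgebra ℝ g] [FiniteDimensional ℝ g]
  (θ : g →ₗ⁅ℝ⁆ g)

theorem killingForm_apply_involution {L : Type*} [LieRing L] [LieAlgebra ℝ L] {σ : L →ₗ⁅ℝ⁆ L}
    (hinv : ∀ x : L, σ (σ x) = x) (x y : L) :
    killingForm ℝ L x (σ y) = killingForm ℝ L (σ x) y := by
  let e : L ≃ₗ⁅ℝ⁆ L := { σ with invFun := σ, left_inv := hinv, right_inv := hinv }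
  have h := LieAlgebra.killingForm_of_equiv_apply e (σ x) y
  have h1 : e (σ x) = x := hinv x
  have h2 : e y = σ y := rfl
  rwa [h1, h2] at h

variable {g θ} in
/-- A subspace stable under a Cartan involution is complemented by its Killing-orthogonal. -/
theorem isCompl_orthogonal_of_involution_stable
    (hpos : ∀ x : g, x ≠ 0 → 0 < -(killingForm ℝ g x (θ x)))
    (S : Submodule ℝ g) (hS : ∀ x ∈ S, θ x ∈ S) :
    IsCompl S (LinearMap.BilinForm.orthogonal (killingForm ℝ g) S) := by
  have hsymm : LinearMap.IsSymm (killingForm ℝ g) := LieModule.traceForm_isSymm ℝ g g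
  rw [LinearMap.BilinForm.isCompl_orthogonal_iff_disjoint hsymm.isRefl, Submodule.disjoint_def]
  intro x hx hx'
  by_contra hne
  have h0 : killingForm ℝ g x (θ x) = 0 :=
    (LieModule.traceForm_comm ℝ g g _ _).trans (hx' (θ x) (hS x hx))
  simpa [h0] using hpos x hne

/-- Let `𝔮 ⊆ 𝔭` be a `𝔨`-invariant subspace, `𝔮'` its Killing-orthogonal complement in
`𝔭`.  Then `[𝔮,𝔮'] = 0`, and `𝔥 = [𝔮,𝔮] + 𝔮` together with its Killing-orthogonal
complement `𝔥'` in `𝔤` are `θ`-stable ideals with `𝔤 = 𝔥 ⊕ 𝔥'` and `[𝔥,𝔥'] = 0`. -/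
theorem invariant_subspace_ideals
    [LieAlgebra.IsSemisimple ℝ g]
    (hinv : ∀ x : g, θ (θ x) = x)
    (hpos : ∀ x : g, x ≠ 0 → 0 < -(killingForm ℝ g x (θ x)))
    (q : Submodule ℝ g)
    (hqP : ∀ x ∈ q, θ x = -x)
    (hkq : ∀ ξ : g, θ ξ = ξ → ∀ x ∈ q, ⁅ξ, x⁆ ∈ q)
    -- `𝔮'`: the orthogonal complement of `𝔮` in `𝔭` with respect to the Killing form
    (q' : Submodule ℝ g)
    (hq' : ∀ y : g, y ∈ q' ↔ (θ y = -y ∧ ∀ x ∈ q, killingForm ℝ g x y = 0))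
    -- `𝔥 = [𝔮,𝔮] + 𝔮` and `𝔥'` its Killing-orthogonal complement in `𝔤`
    (h : Submodule ℝ g)
    (hh : h = Submodule.span ℝ {z : g | (∃ x ∈ q, ∃ y ∈ q, z = ⁅x, y⁆) ∨ z ∈ q})
    (h' : Submodule ℝ g)
    (hh' : ∀ y : g, y ∈ h' ↔ ∀ x ∈ h, killingForm ℝ g x y = 0) :
    (∀ x ∈ q, ∀ y ∈ q', ⁅x, y⁆ = (0 : g)) ∧
    (∀ x ∈ h, θ x ∈ h) ∧ (∀ x ∈ h', θ x ∈ h') ∧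
    (∀ z : g, ∀ x ∈ h, ⁅z, x⁆ ∈ h) ∧ (∀ z : g, ∀ x ∈ h', ⁅z, x⁆ ∈ h') ∧
    h ⊓ h' = ⊥ ∧ h ⊔ h' = ⊤ ∧
    (∀ x ∈ h, ∀ y ∈ h', ⁅x, y⁆ = (0 : g)) := by
  have hinvar : ∀ x y z : g, killingForm ℝ g ⁅x, y⁆ z = killingForm ℝ g x ⁅y, z⁆ :=
    LieModule.traceForm_apply_lie_apply ℝ g g
  have hdef : ∀ x : g, killingForm ℝ g x (θ x) = 0 → x = 0 := by
    intro x hx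
    by_contra hne
    simpa [hx] using hpos x hne
  have hqq : ∀ x ∈ q, ∀ y ∈ q', ⁅x, y⁆ = (0 : g) := by
    intro x hx y hy
    obtain ⟨hy1, hy2⟩ := (hq' y).1 hy
    have hfix : θ ⁅x, y⁆ = ⁅x, y⁆ := by
      rw [LieHom.map_lie, hqP x hx, hy1, neg_lie, lie_neg, neg_neg]
    apply hdef
    rw [hfix, ← hinvar]
    exact hy2 _ (hkq _ hfix x hx)
  have hq_le : ∀ x ∈ q, x ∈ h := fun x hx => hh ▸ Submodule.subset_span (Or.inr hx)
  have hlie_mem : ∀ x ∈ q, ∀ y ∈ q, ⁅x, y⁆ ∈ h := fun x hx y hy =>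
    hh ▸ Submodule.subset_span (Or.inl ⟨x, hx, y, hy, rfl⟩)
  have hfix : ∀ x ∈ q, ∀ y ∈ q, θ ⁅x, y⁆ = ⁅x, y⁆ := by
    intro x hx y hy
    rw [LieHom.map_lie, hqP x hx, hqP y hy, neg_lie, lie_neg, neg_neg]
  have hind : ∀ f : g →ₗ[ℝ] g, (∀ x ∈ q, ∀ y ∈ q, f ⁅x, y⁆ ∈ h) → (∀ x ∈ q, f x ∈ h) →
      ∀ x ∈ h, f x ∈ h := by
    intro f hf1 hf2
    suffices h ≤ h.comap f from this
    conv_lhs => rw [hh]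
    rw [Submodule.span_le]
    rintro z (⟨x, hx, y, hy, rfl⟩ | hz)
    · exact hf1 x hx y hy
    · exact hf2 z hz
  have hθ : ∀ x ∈ h, θ x ∈ h := by
    refine hind (θ : g →ₗ[ℝ] g) (fun x hx y hy => ?_) fun x hx => ?_
    · exact (hfix x hx y hy).symm ▸ hlie_mem x hx y hy
    · exact (hqP x hx).symm ▸ h.neg_mem (hq_le x hx)
  have hθ' : ∀ x ∈ h', θ x ∈ h' := by
    intro y hy
    rw [hh'] at hy ⊢
    intro x hx
    rw [killingForm_apply_involution hinv]
    exact hy _ (hθ x hx)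
  have hk : ∀ z : g, θ z = z → ∀ x ∈ h, ⁅z, x⁆ ∈ h := by
    intro z hz
    refine hind (LieAlgebra.ad ℝ g z) (fun x hx y hy => ?_) fun x hx => ?_
    · rw [LieAlgebra.ad_apply, leibniz_lie]
      exact h.add_mem (hlie_mem _ (hkq z hz x hx) _ hy) (hlie_mem _ hx _ (hkq z hz y hy))
    · exact hq_le _ (hkq z hz x hx)
  have hq_lie : ∀ z ∈ q, ∀ x ∈ h, ⁅z, x⁆ ∈ h := by
    intro z hz
    refine hind (LieAlgebra.ad ℝ g z) (fun x hx y hy => ?_) fun x hx => hlie_mem z hz x hx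
    rw [LieAlgebra.ad_apply, ← lie_skew]
    exact h.neg_mem (hq_le _ (hkq _ (hfix x hx y hy) z hz))
  have hq'_lie : ∀ z ∈ q', ∀ x ∈ h, ⁅z, x⁆ ∈ h := by
    intro z hz
    have hzero : ∀ x ∈ q, ⁅z, x⁆ = 0 := fun x hx => by rw [← lie_skew, hqq x hx z hz, neg_zero]
    refine hind (LieAlgebra.ad ℝ g z) (fun x hx y hy => ?_) fun x hx => ?_
    · rw [LieAlgebra.ad_apply, leibniz_lie, hzero x hx, hzero y hy]
      simp
    · rw [LieAlgebra.ad_apply, hzero x hx]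
      exact h.zero_mem
  have hp : ∀ z : g, θ z = -z → ∀ x ∈ h, ⁅z, x⁆ ∈ h := by
    intro z hz x hx
    have hc := isCompl_orthogonal_of_involution_stable hpos q
      fun x hx => (hqP x hx).symm ▸ q.neg_mem hx
    obtain ⟨a, ha, b, hb, rfl⟩ := Submodule.mem_sup.1 (hc.sup_eq_top ▸ Submodule.mem_top (x := z))
    have hb' : b ∈ q' := by
      refine (hq' b).2 ⟨?_, fun x hx => hb x hx⟩
      rw [map_add, hqP a ha, neg_add] at hz
      exact add_left_cancel hz
    rw [add_lie]
    exact h.add_mem (hq_lie a ha x hx) (hq'_lie b hb' x hx)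
  have hideal : ∀ z : g, ∀ x ∈ h, ⁅z, x⁆ ∈ h := by
    intro z x hx
    have hz : z = (2⁻¹ : ℝ) • ((z + θ z) + (z - θ z)) := by module
    rw [hz, smul_lie, add_lie]
    refine h.smul_mem _ (h.add_mem (hk _ ?_ x hx) (hp _ ?_ x hx))
    · rw [map_add, hinv, add_comm]
    · rw [map_sub, hinv, neg_sub]
  have hideal' : ∀ z : g, ∀ x ∈ h', ⁅z, x⁆ ∈ h' := by
    intro z y hy
    rw [hh'] at hy ⊢
    intro x hx
    rw [← hinvar, ← lie_skew]
    exact hy _ (h.neg_mem (hideal z x hx))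
  have hcompl : IsCompl h h' := by
    have horth : h' = LinearMap.BilinForm.orthogonal (killingForm ℝ g) h := Submodule.ext hh'
    exact horth ▸ isCompl_orthogonal_of_involution_stable hpos h hθ
  refine ⟨hqq, hθ, hθ', hideal, hideal', hcompl.inf_eq_bot, hcompl.sup_eq_top, ?_⟩
  intro x hx y hy
  refine Submodule.disjoint_def.1 hcompl.disjoint _ ?_ (hideal' x y hy)
  rw [← lie_skew]
  exact h.neg_mem (hideal y x hx)

end
end

section
/- Let E be a convex body in a finite-dimensional real inner product space V and let F be a face of E. Then the set C_F = {β ∈ V : F_β(E) = F} is convex and is closed under multiplication by positive real scalars. -/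
open scoped InnerProductSpace

noncomputable section

/-- A convex body: a nonempty compact convex set. -/
def IsConvexBody {V : Type*} [NormedAddCommGroup V] [NormedSpace ℝ V] (E : Set V) : Prop :=
  E.Nonempty ∧ IsCompact E ∧ Convex ℝ E

/-- A face of a convex body `E`: a convex subset `F ⊆ E` such that whenever the relative
interior of a segment `[x,y] ⊆ E` meets `F`, the whole segment is contained in `F`. -/
def IsFace {V : Type*} [NormedAddCommGroup V] [NormedSpace ℝ V] (E F : Set V) : Prop :=
  F ⊆ E ∧ Convex ℝ F ∧
    ∀ x ∈ E, ∀ y ∈ E, (openSegment ℝ x y ∩ F).Nonempty → segment ℝ x y ⊆ F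

/-- The exposed face `F_β(E)` of `E` determined by the vector `β`:
the set of points of `E` where `⟪·, β⟫` attains its maximum over `E`. -/
def exposedFace {V : Type*} [NormedAddCommGroup V] [InnerProductSpace ℝ V] (E : Set V)
    (β : V) : Set V := {x ∈ E | ∀ y ∈ E, ⟪y, β⟫_ℝ ≤ ⟪x, β⟫_ℝ}

/-- A face is exposed if (when nonempty) it has the form `F_β(E)` for some `β`. -/
def IsExposedFace {V : Type*} [NormedAddCommGroup V] [InnerProductSpace ℝ V]
    (E F : Set V) : Prop := F.Nonempty → ∃ β, F = exposedFace E β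

section ExposedFace

variable {V : Type*} [NormedAddCommGroup V] [InnerProductSpace ℝ V] {E : Set V}

theorem exposedFace_smul (β : V) {c : ℝ} (hc : 0 < c) :
    exposedFace E (c • β) = exposedFace E β := by
  simp only [exposedFace, inner_smul_right, mul_le_mul_iff_right₀ hc]

theorem IsCompact.exposedFace_nonempty (hE : IsCompact E) (hne : E.Nonempty) (β : V) :
    (exposedFace E β).Nonempty := by
  obtain ⟨x, hx, hmax⟩ := hE.exists_isMaxOn hne (f := fun y => ⟪y, β⟫_ℝ) (by fun_prop)
  exact ⟨x, hx, fun y hy => hmax hy⟩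

theorem exposedFace_add {β γ : V} (h : (exposedFace E β ∩ exposedFace E γ).Nonempty) :
    exposedFace E (β + γ) = exposedFace E β ∩ exposedFace E γ := by
  obtain ⟨z, ⟨hz, hzβ⟩, -, hzγ⟩ := h
  ext x
  simp only [exposedFace, inner_add_right, Set.mem_inter_iff, Set.mem_ofPred_eq]
  constructor
  · rintro ⟨hx, hmax⟩
    have hxz := hmax z hz
    have hβ := hzβ x hx
    have hγ := hzγ x hx
    exact ⟨⟨hx, fun y hy => by linarith [hzβ y hy]⟩, hx, fun y hy => by linarith [hzγ y hy]⟩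
  · rintro ⟨⟨hx, hβ⟩, -, hγ⟩
    exact ⟨hx, fun y hy => add_le_add (hβ y hy) (hγ y hy)⟩

end ExposedFace

/-- For a face `F` of a convex body `E`, the set `C_F = {β | F_β(E) = F}` is a convex
cone (convex and stable under multiplication by positive scalars). -/
theorem exposing_vectors_convex_cone
    {V : Type*} [NormedAddCommGroup V] [InnerProductSpace ℝ V] [FiniteDimensional ℝ V]
    (E : Set V) (hE : IsConvexBody E) (F : Set V) (hF : IsFace E F) :
    Convex ℝ {β : V | exposedFace E β = F} ∧
    ∀ β ∈ {β : V | exposedFace E β = F}, ∀ c : ℝ, 0 < c →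
      c • β ∈ {β : V | exposedFace E β = F} := by
  refine ⟨convex_iff_forall_pos.mpr ?_, fun β hβ c hc => (exposedFace_smul β hc).trans hβ⟩
  intro β hβ γ hγ a b ha hb _
  have hβ' : exposedFace E (a • β) = F := (exposedFace_smul β ha).trans hβ
  have hγ' : exposedFace E (b • γ) = F := (exposedFace_smul γ hb).trans hγ
  have hF' : F.Nonempty := hβ' ▸ hE.2.1.exposedFace_nonempty hE.1 (a • β)
  have h := exposedFace_add (E := E) (β := a • β) (γ := b • γ)
  rw [hβ', hγ', Set.inter_self] at h
  exact h hF'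

end
end

section
/- Let X be a nonempty compact topological space, V a finite-dimensional real inner product space, f : X → V a continuous map, and E the convex hull of f(X) (a convex body). Let β ∈ V, let m = max_{x∈X} ⟨f(x),β⟩, and let M = {x ∈ X : ⟨f(x),β⟩ = m}. Then f⁻¹(F_β(E)) = M, and F_β(E) equals the convex hull of f(M). -/
open scoped InnerProductSpace

noncomputable section

theorem convex_setOf_inner_le_and_imp {V : Type*} [NormedAddCommGroup V]
    [InnerProductSpace ℝ V] {C : Set V} (hC : Convex ℝ C) (β : V) (m : ℝ) :
    Convex ℝ {x : V | ⟪x, β⟫_ℝ ≤ m ∧ (⟪x, β⟫_ℝ = m → x ∈ C)} := by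
  rw [convex_iff_forall_pos]
  rintro x ⟨hx, hxC⟩ y ⟨hy, hyC⟩ a b ha hb hab
  have hax := mul_le_mul_of_nonneg_left hx ha.le
  have hby := mul_le_mul_of_nonneg_left hy hb.le
  have hsum : a * m + b * m = m := by rw [← add_mul, hab, one_mul]
  simp only [Set.mem_ofPred_eq, inner_add_left, real_inner_smul_left]
  refine ⟨by linarith, fun h => hC (hxC ?_) (hyC ?_) ha.le hb.le hab⟩
  · exact mul_left_cancel₀ ha.ne' (by linarith)
  · exact mul_left_cancel₀ hb.ne' (by linarith)

theorem exposedFace_eq_of_isGreatest {V : Type*} [NormedAddCommGroup V]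
    [InnerProductSpace ℝ V] {E : Set V} {β : V} {m : ℝ}
    (hm : IsGreatest ((fun x => ⟪x, β⟫_ℝ) '' E) m) :
    exposedFace E β = {x ∈ E | ⟪x, β⟫_ℝ = m} := by
  obtain ⟨⟨z, hz, rfl⟩, hub⟩ := hm
  ext x
  refine and_congr_right fun hx => ⟨fun h => (hub ⟨x, hx, rfl⟩).antisymm (h z hz), ?_⟩
  exact fun h y hy => (hub ⟨y, hy, rfl⟩).trans h.ge

theorem isGreatest_inner_image_convexHull {V : Type*} [NormedAddCommGroup V]
    [InnerProductSpace ℝ V] {S : Set V} {β : V} {m : ℝ}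
    (hm : IsGreatest ((fun x => ⟪x, β⟫_ℝ) '' S) m) :
    IsGreatest ((fun x => ⟪x, β⟫_ℝ) '' convexHull ℝ S) m := by
  refine ⟨Set.image_mono (subset_convexHull ℝ S) hm.1, ?_⟩
  rintro _ ⟨x, hx, rfl⟩
  refine (convexHull_min ?_ (convex_setOf_inner_le_and_imp convex_univ β m) hx).1
  exact fun y hy => ⟨hm.2 ⟨y, hy, rfl⟩, fun _ => Set.mem_univ y⟩

theorem exposedFace_convexHull {V : Type*} [NormedAddCommGroup V]
    [InnerProductSpace ℝ V] {S : Set V} {β : V} {m : ℝ}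
    (hm : IsGreatest ((fun x => ⟪x, β⟫_ℝ) '' S) m) :
    exposedFace (convexHull ℝ S) β = convexHull ℝ {x ∈ S | ⟪x, β⟫_ℝ = m} := by
  rw [exposedFace_eq_of_isGreatest (isGreatest_inner_image_convexHull hm)]
  refine Set.Subset.antisymm (fun x ⟨hx, hxm⟩ => ?_) (fun x hx => ?_)
  · refine (convexHull_min ?_
      (convex_setOf_inner_le_and_imp (convex_convexHull ℝ _) β m) hx).2 hxm
    exact fun y hy => ⟨hm.2 ⟨y, hy, rfl⟩, fun h => subset_convexHull ℝ _ ⟨hy, h⟩⟩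
  · refine ⟨convexHull_mono (Set.sep_subset _ _) hx, ?_⟩
    refine convexHull_min ?_ (convex_hyperplane (f := fun y => ⟪y, β⟫_ℝ) ?_ m) hx
    · exact fun y hy => hy.2
    · exact ⟨fun x y => inner_add_left x y β, fun c x => real_inner_smul_left x β c⟩

/-- For a continuous map `f` from a nonempty compact space `X` and
`E = conv (f '' X)`: the preimage of `F_β(E)` is the set `M` of maximizers of
`⟪f ·, β⟫`, and `F_β(E) = conv (f '' M)`. -/
theorem exposedFace_of_convexHull_image
    {X : Type*} [TopologicalSpace X] [CompactSpace X] [Nonempty X]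
    {V : Type*} [NormedAddCommGroup V] [InnerProductSpace ℝ V] [FiniteDimensional ℝ V]
    (f : X → V) (hf : Continuous f) (β : V) (m : ℝ)
    (hm : IsGreatest (Set.range fun x => ⟪f x, β⟫_ℝ) m) :
    f ⁻¹' exposedFace (convexHull ℝ (Set.range f)) β = {x : X | ⟪f x, β⟫_ℝ = m} ∧
    exposedFace (convexHull ℝ (Set.range f)) β =
      convexHull ℝ (f '' {x : X | ⟪f x, β⟫_ℝ = m}) := by
  have hS : IsGreatest ((fun v => ⟪v, β⟫_ℝ) '' Set.range f) m := by
    rwa [← Set.range_comp]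
  constructor
  · rw [exposedFace_eq_of_isGreatest (isGreatest_inner_image_convexHull hS)]
    ext x
    exact and_iff_right (subset_convexHull ℝ _ ⟨x, rfl⟩)
  · rw [exposedFace_convexHull hS]
    congr 1
    ext v
    constructor
    · rintro ⟨⟨x, rfl⟩, hx⟩
      exact ⟨x, hx, rfl⟩
    · rintro ⟨x, hx, rfl⟩
      exact ⟨⟨x, rfl⟩, hx⟩

end
end
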